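/- Let n ≥ 1 and let X be a ball Banach function space over ℝⁿ such that the Hardy–Littlewood maximal operator M is bounded on X and on the Köthe dual X'. Then there exist η > 1, an A₁-weight w on ℝⁿ, and a constant C > 0 such that ‖f‖_{L^η(w)} ≤ C‖f‖_X for all f ∈ X, i.e. X embeds continuously into L^η(w). -/

import Mathlib

open MeasureTheory ENNReal NNReal Filter Topology

noncomputable section

/-- Euclidean space ℝⁿ. -/
abbrev Eucl (n : ℕ) := EuclideanSpace ℝ (Fin n)

/-- The Hardy–Littlewood maximal operator
`M f (x) = sup_{r>0} r^{-n} ∫_{|y-x|<r} f`. -/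
def HLM {n : ℕ} (f : Eucl n → ℝ≥0∞) (x : Eucl n) : ℝ≥0∞ :=
  ⨆ (r : ℝ) (_ : 0 < r),
    (ENNReal.ofReal (r ^ n))⁻¹ * ∫⁻ y in Metric.ball x r, f y

/-- `ρ` is a ball Banach function norm over ℝⁿ: (P1)–(P5), stated on the
nonnegative (`ℝ≥0∞`-valued) measurable functions, together with compatibility
with a.e. equality (well-definedness on `L⁰`). -/
structure IsBBFN (n : ℕ) (ρ : (Eucl n → ℝ≥0∞) → ℝ≥0∞) : Prop where
  ae_congr : ∀ f g : Eucl n → ℝ≥0∞, f =ᵐ[volume] g → ρ f = ρ g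
  zero_iff : ∀ f : Eucl n → ℝ≥0∞, Measurable f → (ρ f = 0 ↔ f =ᵐ[volume] 0)
  smul : ∀ (a : ℝ≥0) (f : Eucl n → ℝ≥0∞), Measurable f →
    ρ (fun x => (a : ℝ≥0∞) * f x) = (a : ℝ≥0∞) * ρ f
  add_le : ∀ f g : Eucl n → ℝ≥0∞, Measurable f → Measurable g →
    ρ (fun x => f x + g x) ≤ ρ f + ρ g
  mono : ∀ f g : Eucl n → ℝ≥0∞, Measurable f → Measurable g →
    (∀ᵐ x ∂volume, f x ≤ g x) → ρ f ≤ ρ g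
  fatou : ∀ (fs : ℕ → Eucl n → ℝ≥0∞) (f : Eucl n → ℝ≥0∞),
    (∀ j, Measurable (fs j)) → Measurable f →
    (∀ᵐ x ∂volume, Monotone (fun j => fs j x)) →
    (∀ᵐ x ∂volume, Tendsto (fun j => fs j x) atTop (𝓝 (f x))) →
    Tendsto (fun j => ρ (fs j)) atTop (𝓝 (ρ f))
  ball_mem : ∀ (x : Eucl n) (r : ℝ), 0 < r →
    ρ (fun y => (Metric.ball x r).indicator (fun _ => (1 : ℝ≥0∞)) y) < ⊤
  ball_lower : ∀ (x : Eucl n) (r : ℝ), 0 < r → ∃ C : ℝ, 0 < C ∧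
    ∀ f : Eucl n → ℝ≥0∞, Measurable f →
      ∫⁻ y in Metric.ball x r, f y ≤ ENNReal.ofReal C * ρ f

/-- The norm `‖f‖_X = ρ(|f|)` of a real-valued function. -/
def normX {n : ℕ} (ρ : (Eucl n → ℝ≥0∞) → ℝ≥0∞) (f : Eucl n → ℝ) : ℝ≥0∞ :=
  ρ (fun x => (‖f x‖₊ : ℝ≥0∞))

/-- The Köthe dual norm `ρ'(g) = sup { ∫ f·g : ρ(f) ≤ 1 }`. -/
def kdual (n : ℕ) (ρ : (Eucl n → ℝ≥0∞) → ℝ≥0∞) : (Eucl n → ℝ≥0∞) → ℝ≥0∞ :=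
  fun g => ⨆ (f : Eucl n → ℝ≥0∞) (_ : Measurable f ∧ ρ f ≤ 1), ∫⁻ x, f x * g x

/-- The Hardy–Littlewood maximal operator is bounded on the space with norm `ρ`. -/
def MBddOn (n : ℕ) (ρ : (Eucl n → ℝ≥0∞) → ℝ≥0∞) : Prop :=
  ∃ C : ℝ, 0 < C ∧ ∀ f : Eucl n → ℝ≥0∞, Measurable f →
    ρ (HLM f) ≤ ENNReal.ofReal C * ρ f

/-- The axes-parallel closed cube with center `x` and radius `r`. -/
def cubeSet {n : ℕ} (x : Eucl n) (r : ℝ) : Set (Eucl n) :=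
  {y | ∀ i, |x i - y i| ≤ r}

/-- The Muckenhoupt `A_p` characteristic
`[w]_{A_p} = sup_Q (|Q|⁻¹∫_Q w) (|Q|⁻¹∫_Q w^{-1/(p-1)})^{p-1}`. -/
def apConst (n : ℕ) (p : ℝ) (w : Eucl n → ℝ≥0∞) : ℝ≥0∞ :=
  ⨆ (x : Eucl n) (r : ℝ) (_ : 0 < r),
    ((volume (cubeSet x r))⁻¹ * ∫⁻ y in cubeSet x r, w y) *
      ((volume (cubeSet x r))⁻¹ * ∫⁻ y in cubeSet x r, w y ^ (-(1/(p-1)))) ^ (p-1)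

/-- A weight: measurable, positive and finite a.e. -/
def IsWeight {n : ℕ} (w : Eucl n → ℝ≥0∞) : Prop :=
  Measurable w ∧ ∀ᵐ x ∂(volume : Measure (Eucl n)), 0 < w x ∧ w x < ⊤

/-- `w ∈ A_p`. -/
def MemAp (n : ℕ) (p : ℝ) (w : Eucl n → ℝ≥0∞) : Prop :=
  IsWeight w ∧ apConst n p w < ⊤

/-- The `A₁` characteristic `[w]_{A₁} = ess sup (M w / w)`. -/
def a1Const (n : ℕ) (w : Eucl n → ℝ≥0∞) : ℝ≥0∞ :=
  essSup (fun x => HLM w x / w x) volume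

/-- The weighted Lebesgue norm, for an `ℝ≥0∞`-valued function. -/
def wLpE (n : ℕ) (p : ℝ) (w : Eucl n → ℝ≥0∞) (F : Eucl n → ℝ≥0∞) : ℝ≥0∞ :=
  (∫⁻ x, F x ^ p * w x) ^ (1/p)

/-- The weighted Lebesgue norm `‖f‖_{L^p(w)} = (∫ |f|^p w)^{1/p}`. -/
def wLp (n : ℕ) (p : ℝ) (w : Eucl n → ℝ≥0∞) (f : Eucl n → ℝ) : ℝ≥0∞ :=
  wLpE n p w (fun x => (‖f x‖₊ : ℝ≥0∞))
lemma hlm_ge {n : ℕ} (f : Eucl n → ℝ≥0∞) (x : Eucl n) {r : ℝ} (hr : 0 < r) :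
    (ENNReal.ofReal (r ^ n))⁻¹ * ∫⁻ y in Metric.ball x r, f y ≤ HLM f x := by
  unfold HLM
  exact le_iSup₂_of_le r hr le_rfl

lemma int_le_hlm {n : ℕ} (f : Eucl n → ℝ≥0∞) (x : Eucl n) {r : ℝ} (hr : 0 < r) :
    ∫⁻ y in Metric.ball x r, f y ≤ ENNReal.ofReal (r ^ n) * HLM f x := by
  have h := hlm_ge f x hr
  have h0 : ENNReal.ofReal (r ^ n) ≠ 0 := by
    simp only [ne_eq, ENNReal.ofReal_eq_zero, not_le]; positivity
  rwa [mul_comm, ← div_eq_mul_inv, ENNReal.div_le_iff' h0 ENNReal.ofReal_ne_top] at h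

lemma measurable_HLM {n : ℕ} (f : Eucl n → ℝ≥0∞) : Measurable (HLM f) := by
  apply measurable_of_Ioi
  intro t
  apply IsOpen.measurableSet
  rw [Metric.isOpen_iff]
  intro x hx
  simp only [Set.mem_preimage, Set.mem_Ioi] at hx
  unfold HLM at hx
  rw [lt_iSup_iff] at hx
  obtain ⟨r, hx⟩ := hx
  rw [lt_iSup_iff] at hx
  obtain ⟨hr, hx⟩ := hx
  -- monotone approximation by smaller balls
  have hU : Metric.ball x r = ⋃ k : ℕ, Metric.ball x (r - 1 / ((k : ℝ) + 1)) := by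
    ext y
    simp only [Metric.mem_ball, Set.mem_iUnion]
    constructor
    · intro hy
      obtain ⟨k, hk⟩ := exists_nat_one_div_lt (sub_pos.2 hy)
      exact ⟨k, by linarith⟩
    · rintro ⟨k, hk⟩
      have : (0:ℝ) < 1 / ((k : ℝ) + 1) := by positivity
      linarith
  have hmono : Monotone (fun k : ℕ => Metric.ball x (r - 1 / ((k : ℝ) + 1))) := by
    intro a b hab
    apply Metric.ball_subset_ball
    have := one_div_le_one_div_of_le (by positivity : (0:ℝ) < (a:ℝ) + 1)
      (by have : (a:ℝ) ≤ b := by exact_mod_cast hab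
          linarith : (a:ℝ) + 1 ≤ (b:ℝ) + 1)
    linarith
  rw [hU, setLIntegral_iUnion_of_directed f hmono.directed_le, ENNReal.mul_iSup, lt_iSup_iff] at hx
  obtain ⟨k, hk⟩ := hx
  refine ⟨1 / ((k : ℝ) + 1), by positivity, ?_⟩
  intro y hy
  simp only [Set.mem_preimage, Set.mem_Ioi]
  refine hk.trans_le (le_trans ?_ (hlm_ge f y hr))
  gcongr
  intro z hz
  simp only [Metric.mem_ball] at *
  have := dist_triangle z x y
  rw [dist_comm x y] at this
  linarith

lemma HLM_const_mul {n : ℕ} (a : ℝ≥0) (f : Eucl n → ℝ≥0∞) (x : Eucl n) :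
    HLM (fun y => (a : ℝ≥0∞) * f y) x = a * HLM f x := by
  unfold HLM
  simp only [ENNReal.mul_iSup]
  refine iSup_congr fun r => iSup_congr fun hr => ?_
  rw [lintegral_const_mul' _ _ ENNReal.coe_ne_top]
  ring

lemma HLM_mono {n : ℕ} {f g : Eucl n → ℝ≥0∞} (h : ∀ x, f x ≤ g x) (x : Eucl n) :
    HLM f x ≤ HLM g x := by
  unfold HLM
  gcongr
  exact h _

lemma HLM_tsum_le {n : ℕ} (f : ℕ → Eucl n → ℝ≥0∞) (hf : ∀ j, Measurable (f j)) (x : Eucl n) :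
    HLM (fun y => ∑' j, f j y) x ≤ ∑' j, HLM (f j) x := by
  conv_lhs => unfold HLM
  refine iSup₂_le fun r hr => ?_
  rw [lintegral_tsum (fun j => (hf j).aemeasurable), ← ENNReal.tsum_mul_left]
  exact ENNReal.tsum_le_tsum fun j => hlm_ge (f j) x hr

/-- Rubio de Francia iteration. -/
lemma rdf {n : ℕ} (N : (Eucl n → ℝ≥0∞) → ℝ≥0∞)
    (hN : ∀ (a : ℕ → ℝ≥0) (f : ℕ → Eucl n → ℝ≥0∞), (∀ j, Measurable (f j)) →
      N (fun x => ∑' j, (a j : ℝ≥0∞) * f j x) ≤ ∑' j, (a j : ℝ≥0∞) * N (f j))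
    (C : ℝ≥0) (hC : 0 < C)
    (hb : ∀ f : Eucl n → ℝ≥0∞, Measurable f → N (HLM f) ≤ C * N f)
    (f : Eucl n → ℝ≥0∞) (hf : Measurable f) :
    ∃ h : Eucl n → ℝ≥0∞, Measurable h ∧ (∀ x, f x ≤ h x) ∧
      (∀ x, HLM h x ≤ ((2 * C : ℝ≥0) : ℝ≥0∞) * h x) ∧ N h ≤ 2 * N f := by
  set F : ℕ → Eucl n → ℝ≥0∞ := fun j => HLM^[j] f with hF
  have hFs : ∀ j, F (j + 1) = HLM (F j) := fun j => Function.iterate_succ_apply' _ _ _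
  have hFm : ∀ j, Measurable (F j) := by
    intro j
    cases j with
    | zero => exact hf
    | succ j => rw [hFs]; exact measurable_HLM _
  have hFN : ∀ j, N (F j) ≤ (C : ℝ≥0∞) ^ j * N f := by
    intro j
    induction j with
    | zero => simp [hF]
    | succ j ih =>
      rw [hFs]
      refine (hb _ (hFm j)).trans ?_
      rw [pow_succ', mul_assoc]
      gcongr
  set a : ℕ → ℝ≥0 := fun j => ((2 * C)⁻¹) ^ j with ha
  have hC2 : (2 * C) ≠ 0 := by positivity
  refine ⟨fun x => ∑' j, (a j : ℝ≥0∞) * F j x, ?_, ?_, ?_, ?_⟩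
  · exact Measurable.ennreal_tsum fun j => (hFm j).const_mul _
  · intro x
    refine le_trans ?_ (ENNReal.le_tsum 0)
    simp [ha, hF]
  · intro x
    refine (HLM_tsum_le _ (fun j => (hFm j).const_mul _) x).trans ?_
    simp only [HLM_const_mul]
    rw [← ENNReal.tsum_mul_left]
    have h1 : ∀ j, (a j : ℝ≥0∞) * HLM (F j) x
        = ((2 * C : ℝ≥0) : ℝ≥0∞) * ((a (j+1) : ℝ≥0∞) * F (j+1) x) := by
      intro j
      rw [hFs, ← mul_assoc, ← ENNReal.coe_mul]
      congr 2
      simp only [ha]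
      rw [pow_succ', ← mul_assoc, mul_inv_cancel₀ hC2, one_mul]
    simp only [h1]
    exact ENNReal.tsum_comp_le_tsum_of_injective (add_left_injective 1)
      (fun j => ((2 * C : ℝ≥0) : ℝ≥0∞) * ((a j : ℝ≥0∞) * F j x))
  · refine (hN a F hFm).trans ?_
    have h2 : ∀ j, (a j : ℝ≥0∞) * N (F j) ≤ (2⁻¹ : ℝ≥0∞) ^ j * N f := by
      intro j
      refine (mul_le_mul_right (hFN j) _).trans (le_of_eq ?_)
      rw [← mul_assoc]
      congr 1
      simp only [ha]
      rw [ENNReal.coe_pow, ← mul_pow]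
      congr 1
      rw [← ENNReal.coe_mul]
      have : (2 * C)⁻¹ * C = 2⁻¹ := by field_simp
      rw [this]
      simp
    refine (ENNReal.tsum_le_tsum h2).trans ?_
    rw [ENNReal.tsum_mul_right, ENNReal.tsum_geometric, ENNReal.one_sub_inv_two, inv_inv]

/-- Volume of the unit ball. -/
def VB (n : ℕ) : ℝ≥0∞ := volume (Metric.ball (0 : Eucl n) 1)

lemma VB_pos (n : ℕ) : 0 < VB n := Metric.measure_ball_pos _ _ one_pos

lemma VB_ne_top (n : ℕ) : VB n ≠ ⊤ := measure_ball_lt_top.ne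

lemma vol_ball {n : ℕ} (x : Eucl n) {r : ℝ} (hr : 0 < r) :
    volume (Metric.ball x r) = ENNReal.ofReal (r ^ n) * VB n := by
  have := Measure.addHaar_ball_of_pos (volume : Measure (Eucl n)) x hr
  rwa [finrank_euclideanSpace_fin] at this

lemma vol_cball {n : ℕ} (x : Eucl n) {r : ℝ} (hr : 0 < r) :
    volume (Metric.closedBall x r) = ENNReal.ofReal (r ^ n) * VB n := by
  have := Measure.addHaar_closedBall (volume : Measure (Eucl n)) x hr.le
  rwa [finrank_euclideanSpace_fin] at this

lemma vol_inter {n : ℕ} (x : Eucl n) {r R : ℝ} (hr : 0 < r) (hrR : r ≤ R)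
    (hx : x ∈ Metric.ball (0 : Eucl n) R) :
    ENNReal.ofReal ((r / 2) ^ n) * VB n ≤
      volume (Metric.closedBall x r ∩ Metric.ball (0 : Eucl n) R) := by
  have hR : 0 < R := hr.trans_le hrR
  rw [← vol_ball ((1 - r / (2 * R)) • x) (half_pos hr)]
  apply measure_mono
  have hx' : ‖x‖ < R := by simpa using hx
  have h1 : r / (2 * R) * R = r / 2 := by field_simp
  have h2 : 0 < r / (2 * R) := by positivity
  have h3 : r / (2 * R) ≤ 1 / 2 := by rw [div_le_iff₀ (by positivity)]; linarith
  have h4 : ‖(1 - r / (2 * R)) • x‖ ≤ R - r / 2 := by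
    rw [norm_smul, Real.norm_of_nonneg (by linarith)]
    calc (1 - r / (2 * R)) * ‖x‖ ≤ (1 - r / (2 * R)) * R := by
          apply mul_le_mul_of_nonneg_left hx'.le; linarith
      _ = R - r / 2 := by rw [sub_mul, h1, one_mul]
  have h5 : dist ((1 - r / (2 * R)) • x) x ≤ r / 2 := by
    rw [dist_eq_norm]
    have : (1 - r / (2 * R)) • x - x = -((r / (2 * R)) • x) := by
      rw [sub_smul, one_smul]; abel
    rw [this, norm_neg, norm_smul, Real.norm_of_nonneg h2.le, ← h1]
    exact mul_le_mul_of_nonneg_left hx'.le h2.le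
  intro y hy
  rw [Metric.mem_ball] at hy
  refine ⟨?_, ?_⟩
  · rw [Metric.mem_closedBall]
    linarith [dist_triangle y ((1 - r / (2 * R)) • x) x]
  · rw [Metric.mem_ball]
    have := dist_triangle y ((1 - r / (2 * R)) • x) 0
    rw [dist_zero_right ((1 - r / (2 * R)) • x)] at this
    linarith

/-- Level set estimate (Calderón–Zygmund/Vitali). -/
lemma level {n : ℕ} (h : Eucl n → ℝ≥0∞) (hm : Measurable h) (K : ℝ≥0)
    (hK : ∀ x, HLM h x ≤ K * h x) (R : ℝ) (hR : 0 < R)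
    (hI : ∫⁻ y in Metric.ball (0 : Eucl n) R, h y ≠ ⊤) (l : ℝ≥0) (hl : 0 < l)
    (h0 : ∫⁻ y in Metric.ball (0 : Eucl n) R, h y ≤ l * volume (Metric.ball (0 : Eucl n) R)) :
    ∫⁻ y in Metric.ball (0 : Eucl n) R ∩ {y | (l : ℝ≥0∞) < h y}, h y ≤
      10 ^ n * l * volume (Metric.ball (0 : Eucl n) R ∩
        {y | (l : ℝ≥0∞) * VB n ≤ 3 ^ n * K * h y}) := by
  set B := Metric.ball (0 : Eucl n) R with hB
  set φ := B.indicator h with hφ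
  have hBm : MeasurableSet B := Metric.isOpen_ball.measurableSet
  have hφm : Measurable φ := hm.indicator hBm
  have hφI : ∫⁻ y, φ y ≠ ⊤ := by rwa [hφ, lintegral_indicator hBm]
  have hφh : ∀ y, φ y ≤ h y := fun y => Set.indicator_le_self _ _ _
  have leb := (Besicovitch.vitaliFamily (volume : Measure (Eucl n))).ae_tendsto_lintegral_div'
    hφm hφI
  set T : Set (Eucl n) := {x | x ∈ B ∧ (l : ℝ≥0∞) < h x ∧
    Tendsto (fun a => (∫⁻ y in a, φ y) / volume a)
      ((Besicovitch.vitaliFamily (volume : Measure (Eucl n))).filterAt x) (𝓝 (φ x))} with hT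
  have key : ∀ x ∈ T, ∃ r : ℝ, 0 < r ∧ r ≤ R ∧
      (l : ℝ≥0∞) * volume (Metric.closedBall x r) ≤ ∫⁻ y in Metric.closedBall x r, φ y ∧
      ∫⁻ y in Metric.closedBall x (5 * r), φ y ≤ l * volume (Metric.closedBall x (5 * r)) := by
    rintro x ⟨hxB, hxl, hxt⟩
    have hs : Tendsto (fun j : ℕ => 5 * R * (1 / 5 : ℝ) ^ j) atTop (𝓝[>] 0) := by
      rw [tendsto_nhdsWithin_iff]
      constructor
      · have := (tendsto_pow_atTop_nhds_zero_of_lt_one (by norm_num : (0:ℝ) ≤ 1/5)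
          (by norm_num)).const_mul (5 * R)
        simpa using this
      · exact Eventually.of_forall fun j => by simp only [Set.mem_Ioi]; positivity
    have h1 := (hxt.comp (Besicovitch.tendsto_filterAt volume x)).comp hs
    have h2 : φ x = h x := Set.indicator_of_mem hxB _
    rw [h2] at h1
    have h3 := (h1.eventually (lt_mem_nhds hxl)).exists
    have h4 : ∃ j : ℕ, (l : ℝ≥0∞) * volume (Metric.closedBall x (5 * R * (1 / 5 : ℝ) ^ j)) <
        ∫⁻ y in Metric.closedBall x (5 * R * (1 / 5 : ℝ) ^ j), φ y := by
      obtain ⟨j, hj⟩ := h3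
      refine ⟨j, ?_⟩
      simp only [Function.comp] at hj
      exact ENNReal.mul_lt_of_lt_div hj
    classical
    have hj := Nat.find_spec h4
    have hmin := fun m => Nat.find_min h4 (m := m)
    set j := Nat.find h4
    have hj0 : j ≠ 0 := by
      intro hj0
      rw [hj0] at hj
      simp only [pow_zero, mul_one] at hj
      refine absurd hj (not_lt.2 ?_)
      calc ∫⁻ y in Metric.closedBall x (5 * R), φ y ≤ ∫⁻ y, φ y := setLIntegral_le_lintegral _ _
        _ = ∫⁻ y in B, h y := by rw [hφ, lintegral_indicator hBm]
        _ ≤ l * volume B := h0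
        _ ≤ _ := by
          gcongr
          intro y hy
          simp only [hB, Metric.mem_ball, Metric.mem_closedBall] at *
          have := dist_triangle_right y x 0
          linarith
    obtain ⟨i, hi⟩ := Nat.exists_eq_succ_of_ne_zero hj0
    have h5 := hmin i (by omega)
    rw [hi] at hj
    have h6 : 5 * (5 * R * (1 / 5 : ℝ) ^ (i + 1)) = 5 * R * (1 / 5 : ℝ) ^ i := by
      rw [pow_succ]; ring
    refine ⟨5 * R * (1 / 5 : ℝ) ^ (i + 1), by positivity, ?_, hj.le, ?_⟩
    · have : (1 / 5 : ℝ) ^ i ≤ 1 := pow_le_one₀ (by norm_num) (by norm_num)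
      nlinarith
    · rw [h6]; exact not_lt.1 h5
  choose! r hr0 hrR hr1 hr2 using key
  obtain ⟨u, huT, hud, huc⟩ := Vitali.exists_disjoint_subfamily_covering_enlargement_closedBall T
    (fun x => x) r R hrR 5 (by norm_num)
  have hucount : u.Countable := hud.countable_of_nonempty_interior fun x hx =>
    (Metric.nonempty_ball.2 (hr0 x (huT hx))).mono Metric.ball_subset_interior_closedBall
  have := hucount.to_subtype
  have step1 : ∫⁻ y in B ∩ {y | (l : ℝ≥0∞) < h y}, h y ≤
      ∫⁻ y in ⋃ b : u, Metric.closedBall (b : Eucl n) (5 * r b), φ y := by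
    have hmS : MeasurableSet (B ∩ {y | (l : ℝ≥0∞) < h y}) :=
      hBm.inter (measurableSet_lt measurable_const hm)
    rw [setLIntegral_congr_fun (g := φ) hmS
      (fun y hy => (Set.indicator_of_mem hy.1 h).symm)]
    apply lintegral_mono_set'
    filter_upwards [leb] with x hx hxS
    have hxT : x ∈ T := ⟨hxS.1, hxS.2, hx⟩
    obtain ⟨b, hb, hsub⟩ := huc x hxT
    exact Set.mem_iUnion.2 ⟨⟨b, hb⟩, hsub (Metric.mem_closedBall_self (hr0 x hxT).le)⟩
  refine step1.trans ((lintegral_iUnion_le _ _).trans ?_)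
  have step2 : ∀ b : u, ∫⁻ y in Metric.closedBall (b : Eucl n) (5 * r b), φ y ≤
      10 ^ n * l * volume (Metric.closedBall (b : Eucl n) (r b) ∩ B) := by
    rintro ⟨b, hb⟩
    have hbT := huT hb
    have hp := hr0 b hbT
    refine (hr2 b hbT).trans ?_
    refine le_trans ?_ (mul_le_mul_right (vol_inter b hp (hrR b hbT) hbT.1) _)
    rw [vol_cball b (by positivity)]
    have e : (5 * r b) ^ n = 10 ^ n * (r b / 2) ^ n := by rw [← mul_pow]; congr 1; ring
    have e2 : ENNReal.ofReal ((10:ℝ) ^ n) = 10 ^ n := by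
      rw [ENNReal.ofReal_pow (by norm_num)]; norm_num
    rw [e, ENNReal.ofReal_mul (by positivity), e2]
    apply le_of_eq; ring
  refine (ENNReal.tsum_le_tsum step2).trans ?_
  rw [ENNReal.tsum_mul_left]
  gcongr
  rw [← measure_iUnion]
  · apply measure_mono
    apply Set.iUnion_subset
    rintro ⟨b, hb⟩ y ⟨hy, hyB⟩
    refine ⟨hyB, ?_⟩
    have hbT := huT hb
    have hp := hr0 b hbT
    have h1 := int_le_hlm h y (r := 3 * r b) (by positivity)
    have h2 := (hr1 b hbT).trans (lintegral_mono (hφh))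
    have h3 : ∫⁻ y in Metric.closedBall b (r b), h y ≤ ∫⁻ z in Metric.ball y (3 * r b), h z := by
      apply lintegral_mono_set
      intro z hz
      simp only [Metric.mem_ball, Metric.mem_closedBall] at *
      have := dist_triangle_right z y b
      linarith
    have h4 := (h2.trans h3).trans (h1.trans (mul_le_mul_right (hK y) _))
    rw [vol_cball b hp, mul_pow, ENNReal.ofReal_mul (by positivity)] at h4
    have e2 : ENNReal.ofReal ((3:ℝ) ^ n) = 3 ^ n := by
      rw [ENNReal.ofReal_pow (by norm_num)]; norm_num
    rw [e2] at h4
    have hq0 : ENNReal.ofReal (r b ^ n) ≠ 0 := by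
      simp only [ne_eq, ENNReal.ofReal_eq_zero, not_le]; positivity
    simp only [Set.mem_setOf_eq]
    rw [← ENNReal.mul_le_mul_iff_right hq0 ENNReal.ofReal_ne_top]
    calc _ = (l : ℝ≥0∞) * (ENNReal.ofReal (r b ^ n) * VB n) := by ring
      _ ≤ _ := h4
      _ = _ := by ring
  · intro a b hab
    have := hud a.2 b.2 (fun h => hab (Subtype.ext h))
    exact Set.disjoint_of_subset Set.inter_subset_left Set.inter_subset_left this
  · intro b
    exact (Metric.isClosed_closedBall.measurableSet).inter hBm

lemma level' (n : ℕ) (K : ℝ≥0) : ∃ c : ℝ≥0, 0 < c ∧ c ≤ 1 ∧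
    ∀ (h : Eucl n → ℝ≥0∞), Measurable h → (∀ x, HLM h x ≤ K * h x) →
    ∀ (R : ℝ), 0 < R → ∫⁻ y in Metric.ball (0 : Eucl n) R, h y ≠ ⊤ →
    ∀ (l : ℝ≥0), 0 < l →
    ∫⁻ y in Metric.ball (0 : Eucl n) R, h y ≤ l * volume (Metric.ball (0 : Eucl n) R) →
    ∫⁻ y in Metric.ball (0 : Eucl n) R ∩ {y | (l : ℝ≥0∞) < h y}, h y ≤
      10 ^ n * l * volume (Metric.ball (0 : Eucl n) R ∩
        {y | ((c * l : ℝ≥0) : ℝ≥0∞) < h y}) := by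
  obtain ⟨v, hv⟩ : ∃ v : ℝ≥0, (v : ℝ≥0∞) = VB n := ⟨(VB n).toNNReal, ENNReal.coe_toNNReal (VB_ne_top n)⟩
  have hv0 : 0 < v := by
    have := VB_pos n
    rw [← hv] at this
    exact_mod_cast this
  have hd : 0 < 3 ^ n * K + v + 1 := by positivity
  refine ⟨v / (3 ^ n * K + v + 1), by positivity, ?_, ?_⟩
  · rw [div_le_one hd, add_assoc, add_comm v 1, ← add_assoc]
    exact le_add_self
  · intro h hm hK R hR hI l hl h0
    refine (level h hm K hK R hR hI l hl h0).trans ?_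
    gcongr
    intro hy'
    show ((v / (3 ^ n * K + v + 1) * l : ℝ≥0) : ℝ≥0∞) < h y
    by_contra hcon
    rw [not_lt] at hcon
    have h1 : (l : ℝ≥0∞) * VB n ≤ 3 ^ n * K * ((v / (3 ^ n * K + v + 1) * l : ℝ≥0) : ℝ≥0∞) :=
      hy'.trans (mul_le_mul_right hcon _)
    rw [← hv] at h1
    have h2 : l * v ≤ 3 ^ n * K * (v / (3 ^ n * K + v + 1) * l) := by exact_mod_cast h1
    have h3 : 3 ^ n * K * (v / (3 ^ n * K + v + 1) * l) =
       (3 ^ n * K) / (3 ^ n * K + v + 1) * (l * v) := by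
      field_simp
    rw [h3] at h2
    have h4 : (3 ^ n * K) / (3 ^ n * K + v + 1) < 1 := by
      rw [div_lt_one hd, add_assoc]
      exact lt_add_of_pos_right _ (by positivity)
    have h5 := mul_lt_mul_of_pos_right h4 (by positivity : 0 < l * v)
    rw [one_mul] at h5
    exact absurd h2 (not_le.2 h5)

lemma decay (n : ℕ) (K : ℝ≥0) : ∃ b θ s : ℝ≥0, 1 < b ∧ 0 < θ ∧ θ < 1 ∧ 0 < s ∧ s ≤ 1 ∧
    ∀ (h : Eucl n → ℝ≥0∞), Measurable h → (∀ x, HLM h x ≤ K * h x) →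
    ∀ (R : ℝ), 0 < R → ∫⁻ y in Metric.ball (0 : Eucl n) R, h y ≠ ⊤ →
    ∀ (l : ℝ≥0), 0 < l →
    ∫⁻ y in Metric.ball (0 : Eucl n) R, h y ≤ l * volume (Metric.ball (0 : Eucl n) R) →
    ∀ k : ℕ,
    ∫⁻ y in Metric.ball (0 : Eucl n) R ∩ {y | ((b ^ k * (s * l) : ℝ≥0) : ℝ≥0∞) < h y}, h y ≤
      (θ : ℝ≥0∞) ^ k * ∫⁻ y in Metric.ball (0 : Eucl n) R, h y := by
  obtain ⟨c, hc0, hc1, H⟩ := level' n K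
  set D : ℝ≥0 := 10 ^ n with hD
  have hD1 : 1 ≤ D := one_le_pow₀ (by norm_num)
  have hD0 : 0 < D := by positivity
  have hdd : 0 < c + 2 * D := by positivity
  have hcA : c < 2 * D := by
    calc c ≤ 1 := hc1
      _ < 2 * 1 := by norm_num
      _ ≤ 2 * D := by gcongr
  have hb1 : 1 < 2 * D / c := by rwa [one_lt_div hc0]
  refine ⟨2 * D / c, 2 * D / (c + 2 * D), c, hb1, by positivity, ?_, hc0, hc1, ?_⟩
  · rw [div_lt_one hdd]; exact lt_add_of_pos_left _ hc0
  intro h hm hK R hR hI l hl h0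
  set B := Metric.ball (0 : Eucl n) R with hB
  have hBm : MeasurableSet B := Metric.isOpen_ball.measurableSet
  have hEm : ∀ t : ℝ≥0, MeasurableSet (B ∩ {y | (t : ℝ≥0∞) < h y}) := fun t =>
      hBm.inter (measurableSet_lt measurable_const hm)
  have one : ∀ t : ℝ≥0, l ≤ t →
      ∫⁻ y in B ∩ {y | ((2 * D * t : ℝ≥0) : ℝ≥0∞) < h y}, h y ≤
      ((2 * D / (c + 2 * D) : ℝ≥0) : ℝ≥0∞) *
        ∫⁻ y in B ∩ {y | ((c * t : ℝ≥0) : ℝ≥0∞) < h y}, h y := by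
    intro t ht
    have ht0 : 0 < t := hl.trans_le ht
    have hL := H h hm hK R hR hI t ht0 (h0.trans (by gcongr))
    set E1 := B ∩ {y | ((c * t : ℝ≥0) : ℝ≥0∞) < h y} with hE1
    set E2 := B ∩ {y | ((2 * D * t : ℝ≥0) : ℝ≥0∞) < h y} with hE2
    have hsub : E2 ⊆ E1 := by
      rintro y ⟨hy1, hy2⟩
      refine ⟨hy1, show ((c * t : ℝ≥0) : ℝ≥0∞) < h y from lt_of_le_of_lt ?_ hy2⟩
      have : c * t ≤ 2 * D * t := by gcongr
      exact_mod_cast this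
    set u2 := ∫⁻ y in E2, h y with hu2
    set v := ∫⁻ y in E1 \ E2, h y with hv
    have hu1 : ∫⁻ y in E1, h y = u2 + v := by
      rw [← lintegral_inter_add_sdiff h E1 (hEm (2 * D * t)), Set.inter_eq_self_of_subset_right hsub]
    have hu2t : u2 ≠ ⊤ := ne_top_of_le_ne_top hI (lintegral_mono_set Set.inter_subset_left)
    have hm12 : volume E1 = volume E2 + volume (E1 \ E2) := by
      rw [← measure_inter_add_sdiff E1 (hEm (2 * D * t)), Set.inter_eq_self_of_subset_right hsub]
    have hle : u2 ≤ 10 ^ n * t * volume E1 := by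
      refine le_trans (lintegral_mono_set ?_) hL
      rintro y ⟨hy1, hy2⟩
      refine ⟨hy1, show (t : ℝ≥0∞) < h y from lt_of_le_of_lt ?_ hy2⟩
      have : 1 * t ≤ 2 * D * t := by
        gcongr
        exact hD1.trans (by rw [two_mul]; exact le_self_add)
      rw [one_mul] at this
      exact_mod_cast this
    have hv1 : ((c * t : ℝ≥0) : ℝ≥0∞) * volume (E1 \ E2) ≤ v := by
      rw [← setLIntegral_const]
      exact setLIntegral_mono hm fun y hy => hy.1.2.le
    have hv2 : ((2 * D * t : ℝ≥0) : ℝ≥0∞) * volume E2 ≤ u2 := by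
      rw [← setLIntegral_const]
      exact setLIntegral_mono hm fun y hy => hy.2.le
    have hDc : (10 : ℝ≥0∞) ^ n = (D : ℝ≥0∞) := by rw [hD]; push_cast; rfl
    rw [hDc] at hle
    push_cast at hv1 hv2
    have h1 : (c : ℝ≥0∞) * u2 + c * u2 ≤ 2 * D * v + c * u2 := by
      calc (c : ℝ≥0∞) * u2 + c * u2 = 2 * c * u2 := by ring
        _ ≤ 2 * c * (D * t * volume E1) := by gcongr
        _ = 2 * D * (c * t * volume (E1 \ E2)) + c * (2 * D * t * volume E2) := by
          rw [hm12]; ring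
        _ ≤ _ := by gcongr
    have h2 := (ENNReal.add_le_add_iff_right (ENNReal.mul_ne_top ENNReal.coe_ne_top hu2t)).1 h1
    rw [hu1, ENNReal.coe_div hdd.ne', ← ENNReal.mul_div_right_comm,
      ENNReal.le_div_iff_mul_le (Or.inl (by exact_mod_cast hdd.ne')) (Or.inl ENNReal.coe_ne_top)]
    push_cast
    calc u2 * ((c : ℝ≥0∞) + 2 * D) = c * u2 + 2 * D * u2 := by ring
      _ ≤ 2 * D * v + 2 * D * u2 := by gcongr
      _ = _ := by ring
  intro k
  induction k with
  | zero =>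
    rw [pow_zero, pow_zero, one_mul, one_mul]
    exact lintegral_mono_set Set.inter_subset_left
  | succ k ih =>
    have e1 : (2 * D / c) ^ (k + 1) * (c * l) = 2 * D * ((2 * D / c) ^ k * l) := by
      rw [pow_succ]; field_simp
    have e2 : (2 * D / c) ^ k * (c * l) = c * ((2 * D / c) ^ k * l) := by ring
    rw [e1]
    rw [e2] at ih
    refine (one _ ?_).trans ?_
    · exact le_mul_of_one_le_left l.2 (one_le_pow₀ hb1.le)
    · rw [pow_succ', mul_assoc]
      gcongr

lemma ptwise (b s : ℝ≥0) (hb : 1 < b) (hs : 0 < s) (ε : ℝ) (hε : 0 < ε) (y : ℝ≥0∞) (hy : y ≠ ⊤) :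
    y ^ ε ≤ (s : ℝ≥0∞) ^ ε + ∑' k : ℕ, ((b ^ (k + 1) * s : ℝ≥0) : ℝ≥0∞) ^ ε *
      (if ((b ^ k * s : ℝ≥0) : ℝ≥0∞) < y then 1 else 0) := by
  lift y to ℝ≥0 using hy
  by_cases hys : y ≤ s
  · refine le_trans ?_ le_self_add
    gcongr
  have hex : ∃ k : ℕ, y ≤ b ^ k * s := by
    obtain ⟨k, hk⟩ := pow_unbounded_of_one_lt (y / s) hb
    exact ⟨k, by rw [div_lt_iff₀ hs] at hk; exact hk.le⟩
  classical
  have h1 := Nat.find_spec hex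
  have h2 := fun m => Nat.find_min hex (m := m)
  set j := Nat.find hex
  have hj : j ≠ 0 := by
    intro hj
    rw [hj, pow_zero, one_mul] at h1
    exact hys h1
  obtain ⟨i, hi⟩ := Nat.exists_eq_succ_of_ne_zero hj
  have h3 := h2 i (by omega)
  rw [hi] at h1
  refine le_trans ?_ le_add_self
  refine le_trans ?_ (ENNReal.le_tsum i)
  rw [if_pos (by exact_mod_cast not_le.1 h3), mul_one]
  gcongr

/-- Reverse Hölder inequality. -/
lemma revHolder (n : ℕ) (K : ℝ≥0) : ∃ (ε : ℝ) (Q : ℝ≥0∞), 0 < ε ∧ Q ≠ ⊤ ∧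
    ∀ (h : Eucl n → ℝ≥0∞), Measurable h → (∀ x, HLM h x ≤ K * h x) →
    ∀ (R : ℝ), 0 < R → ∫⁻ y in Metric.ball (0 : Eucl n) R, h y ≠ ⊤ →
    ∀ (l : ℝ≥0), 0 < l →
    ∫⁻ y in Metric.ball (0 : Eucl n) R, h y ≤ l * volume (Metric.ball (0 : Eucl n) R) →
    ∫⁻ y in Metric.ball (0 : Eucl n) R, h y ^ (1 + ε) ≤
      Q * ((l : ℝ≥0∞) ^ (1 + ε) * volume (Metric.ball (0 : Eucl n) R)) := by
  obtain ⟨b, θ, s, hb, hθ0, hθ1, hs0, hs1, H⟩ := decay n K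
  obtain ⟨ε, hε, hεb⟩ : ∃ ε : ℝ, 0 < ε ∧ b ^ ε * θ < 1 := by
    have ht : Tendsto (fun ε : ℝ => b ^ ε * θ) (𝓝[>] 0) (𝓝 (b ^ (0:ℝ) * θ)) := by
      apply Tendsto.mono_left _ nhdsWithin_le_nhds
      apply Filter.Tendsto.mul_const
      exact tendsto_const_nhds.nnrpow tendsto_id (Or.inl (by positivity))
    rw [NNReal.rpow_zero, one_mul] at ht
    obtain ⟨ε, h1, h2⟩ := ((ht.eventually (gt_mem_nhds hθ1)).and self_mem_nhdsWithin).exists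
    exact ⟨ε, h2, h1⟩
  have hlt : ((b ^ ε * θ : ℝ≥0) : ℝ≥0∞) < 1 := by exact_mod_cast hεb
  set Q : ℝ≥0∞ := 1 + ((b ^ ε : ℝ≥0) : ℝ≥0∞) * (1 - ((b ^ ε * θ : ℝ≥0) : ℝ≥0∞))⁻¹ with hQ
  refine ⟨ε, Q, hε, ?_, ?_⟩
  · refine ENNReal.add_ne_top.2 ⟨ENNReal.one_ne_top, ENNReal.mul_ne_top ENNReal.coe_ne_top ?_⟩
    rw [ENNReal.inv_ne_top]
    exact (tsub_pos_of_lt hlt).ne'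
  intro h hm hK R hR hI l hl h0
  have Hk := H h hm hK R hR hI l hl h0
  set B := Metric.ball (0 : Eucl n) R with hB
  have hBm : MeasurableSet B := Metric.isOpen_ball.measurableSet
  have hEm : ∀ t : ℝ≥0, MeasurableSet {y | (t : ℝ≥0∞) < h y} := fun t =>
      (measurableSet_lt measurable_const hm)
  set I := ∫⁻ y in B, h y with hIdef
  have hfin : ∀ᵐ y ∂(volume.restrict B), h y < ⊤ := ae_lt_top hm hI
  have hs : 0 < s * l := by positivity
  calc ∫⁻ y in B, h y ^ (1 + ε)
      ≤ ∫⁻ y in B, (((s * l : ℝ≥0) : ℝ≥0∞) ^ ε * h y +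
          ∑' k : ℕ, ((b ^ (k + 1) * (s * l) : ℝ≥0) : ℝ≥0∞) ^ ε *
            ({y | ((b ^ k * (s * l) : ℝ≥0) : ℝ≥0∞) < h y}.indicator h y)) := by
        apply lintegral_mono_ae
        filter_upwards [hfin] with y hy
        rw [ENNReal.rpow_add_of_nonneg _ _ zero_le_one hε.le, ENNReal.rpow_one]
        refine (mul_le_mul_right (ptwise b (s * l) hb hs ε hε (h y) hy.ne) _).trans ?_
        rw [mul_add, mul_comm (h y), ← ENNReal.tsum_mul_left]
        refine add_le_add le_rfl (ENNReal.tsum_le_tsum fun k => ?_)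
        by_cases hk : ((b ^ k * (s * l) : ℝ≥0) : ℝ≥0∞) < h y
        · rw [if_pos hk, Set.indicator_of_mem (by exact hk), mul_one, mul_comm]
        · rw [if_neg hk]; simp
    _ = ((s * l : ℝ≥0) : ℝ≥0∞) ^ ε * I + ∑' k : ℕ, ((b ^ (k + 1) * (s * l) : ℝ≥0) : ℝ≥0∞) ^ ε *
          ∫⁻ y in B ∩ {y | ((b ^ k * (s * l) : ℝ≥0) : ℝ≥0∞) < h y}, h y := by
        rw [lintegral_add_left (hm.const_mul _), lintegral_const_mul _ hm, lintegral_tsum]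
        · congr 2
          ext k
          rw [lintegral_const_mul _ (hm.indicator (hEm _)), lintegral_indicator (hEm _),
            Measure.restrict_restrict (hEm _), Set.inter_comm]
        · intro k
          exact ((hm.indicator (hEm _)).const_mul _).aemeasurable
    _ ≤ ((s * l : ℝ≥0) : ℝ≥0∞) ^ ε * I + ∑' k : ℕ, ((b ^ (k + 1) * (s * l) : ℝ≥0) : ℝ≥0∞) ^ ε *
          ((θ : ℝ≥0∞) ^ k * I) := by
        gcongr with k
        exact Hk k
    _ = ((s * l : ℝ≥0) : ℝ≥0∞) ^ ε * I * Q := by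
        have e : ∀ k : ℕ, ((b ^ (k + 1) * (s * l) : ℝ≥0) : ℝ≥0∞) ^ ε * ((θ : ℝ≥0∞) ^ k * I) =
            ((s * l : ℝ≥0) : ℝ≥0∞) ^ ε * I * ((b ^ ε : ℝ≥0) : ℝ≥0∞) *
              ((b ^ ε * θ : ℝ≥0) : ℝ≥0∞) ^ k := by
          intro k
          rw [ENNReal.coe_mul, ENNReal.mul_rpow_of_nonneg _ _ hε.le, ENNReal.coe_pow,
            ← ENNReal.rpow_natCast, ← ENNReal.rpow_mul, mul_comm ((k + 1 : ℕ) : ℝ) ε,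
            ENNReal.rpow_mul, ENNReal.rpow_natCast, ← ENNReal.coe_rpow_of_nonneg _ hε.le,
            pow_succ, ENNReal.coe_mul (b ^ ε) θ, mul_pow]
          ring
        simp only [e]
        rw [ENNReal.tsum_mul_left, ENNReal.tsum_geometric, hQ]
        ring
    _ ≤ (l : ℝ≥0∞) ^ ε * (l * volume B) * Q := by
        gcongr
        exact mul_le_of_le_one_left l.2 hs1
    _ = _ := by
        rw [ENNReal.rpow_add_of_nonneg _ _ zero_le_one hε.le, ENNReal.rpow_one]
        ring

lemma rho_tsum {n : ℕ} {ρ : (Eucl n → ℝ≥0∞) → ℝ≥0∞} (hρ : IsBBFN n ρ)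
    (a : ℕ → ℝ≥0) (f : ℕ → Eucl n → ℝ≥0∞) (hf : ∀ j, Measurable (f j)) :
    ρ (fun x => ∑' j, (a j : ℝ≥0∞) * f j x) ≤ ∑' j, (a j : ℝ≥0∞) * ρ (f j) := by
  have hpm : ∀ m, Measurable (fun x => ∑ j ∈ Finset.range m, (a j : ℝ≥0∞) * f j x) := fun m =>
    Finset.measurable_fun_sum _ fun j _ => (hf j).const_mul _
  have hfin : ∀ m, ρ (fun x => ∑ j ∈ Finset.range m, (a j : ℝ≥0∞) * f j x) ≤
      ∑ j ∈ Finset.range m, (a j : ℝ≥0∞) * ρ (f j) := by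
    intro m
    induction m with
    | zero =>
      simp only [Finset.range_zero, Finset.sum_empty]
      exact le_of_eq ((hρ.zero_iff _ measurable_const).2 (Eventually.of_forall fun _ => rfl))
    | succ m ih =>
      simp only [Finset.sum_range_succ]
      refine (hρ.add_le _ _ (hpm m) ((hf m).const_mul _)).trans ?_
      rw [hρ.smul _ _ (hf m)]
      gcongr
  have ht := hρ.fatou (fun m x => ∑ j ∈ Finset.range m, (a j : ℝ≥0∞) * f j x)
    (fun x => ∑' j, (a j : ℝ≥0∞) * f j x) hpm
    (Measurable.ennreal_tsum fun j => (hf j).const_mul _)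
    (Eventually.of_forall fun x => by
      intro i j hij
      exact Finset.sum_le_sum_of_subset (Finset.range_mono hij))
    (Eventually.of_forall fun x => ENNReal.tendsto_nat_tsum _)
  exact le_of_tendsto ht (Eventually.of_forall fun m => (hfin m).trans (ENNReal.sum_le_tsum _))

lemma kdual_tsum {n : ℕ} (ρ : (Eucl n → ℝ≥0∞) → ℝ≥0∞)
    (a : ℕ → ℝ≥0) (f : ℕ → Eucl n → ℝ≥0∞) (hf : ∀ j, Measurable (f j)) :
    kdual n ρ (fun x => ∑' j, (a j : ℝ≥0∞) * f j x) ≤ ∑' j, (a j : ℝ≥0∞) * kdual n ρ (f j) := by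
  conv_lhs => unfold kdual
  refine iSup₂_le fun φ hφ => ?_
  have e : ∀ x, φ x * ∑' j, (a j : ℝ≥0∞) * f j x = ∑' j, (a j : ℝ≥0∞) * (φ x * f j x) := by
    intro x
    rw [← ENNReal.tsum_mul_left]
    congr 1
    ext j
    ring
  simp only [e]
  have hmm : ∀ j, Measurable (fun x => φ x * f j x) := fun j => hφ.1.mul (hf j)
  rw [lintegral_tsum (fun j => ((hmm j).const_mul _).aemeasurable)]
  refine ENNReal.tsum_le_tsum fun j => ?_
  rw [lintegral_const_mul _ (hmm j)]
  gcongr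
  exact le_iSup₂_of_le φ hφ le_rfl

lemma kdual_holder {n : ℕ} {ρ : (Eucl n → ℝ≥0∞) → ℝ≥0∞} (hρ : IsBBFN n ρ)
    (f g : Eucl n → ℝ≥0∞) (hf : Measurable f) (hg : Measurable g) (h0 : ρ f ≠ 0) (ht : ρ f ≠ ⊤) :
    ∫⁻ x, f x * g x ≤ ρ f * kdual n ρ g := by
  set a : ℝ≥0 := (ρ f).toNNReal⁻¹ with ha
  have hn : (ρ f).toNNReal ≠ 0 := by
    simp [ENNReal.toNNReal_eq_zero_iff, h0, ht]
  have hac : (a : ℝ≥0∞) = (ρ f)⁻¹ := by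
    rw [ha, ENNReal.coe_inv hn, ENNReal.coe_toNNReal ht]
  have h1 : ρ (fun x => (a : ℝ≥0∞) * f x) ≤ 1 := by
    rw [hρ.smul _ _ hf, hac, ENNReal.inv_mul_cancel h0 ht]
  have h2 : ∫⁻ x, ((a : ℝ≥0∞) * f x) * g x ≤ kdual n ρ g := by
    unfold kdual
    exact le_iSup₂_of_le (fun x => (a : ℝ≥0∞) * f x) ⟨hf.const_mul _, h1⟩ le_rfl
  simp only [mul_assoc] at h2
  have hmm : Measurable (fun x => f x * g x) := hf.mul hg
  rw [lintegral_const_mul _ hmm, hac] at h2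
  calc ∫⁻ x, f x * g x = ρ f * ((ρ f)⁻¹ * ∫⁻ x, f x * g x) := by
        rw [← mul_assoc, ENNReal.mul_inv_cancel h0 ht, one_mul]
    _ ≤ _ := by gcongr

/-- The dyadic balls centred at the origin. -/
def DB (n k : ℕ) : Set (Eucl n) := Metric.ball 0 ((2:ℝ) ^ k)

/-- Indicator of the dyadic balls. -/
def chi (n k : ℕ) : Eucl n → ℝ≥0∞ := fun y => (DB n k).indicator (fun _ => (1 : ℝ≥0∞)) y

lemma DB_meas (n k : ℕ) : MeasurableSet (DB n k) := Metric.isOpen_ball.measurableSet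

lemma chi_meas (n k : ℕ) : Measurable (chi n k) := measurable_const.indicator (DB_meas n k)

lemma ofReal_two_pow (k n : ℕ) : ENNReal.ofReal (((2:ℝ) ^ k) ^ n) = (2 ^ k) ^ n := by
  rw [ENNReal.ofReal_pow (by positivity), ENNReal.ofReal_pow (by norm_num)]; norm_num

lemma vol_DB (n k : ℕ) : volume (DB n k) = (2 ^ k) ^ n * VB n := by
  unfold DB
  rw [vol_ball _ (by positivity), ofReal_two_pow]

lemma rho_chi_top {n : ℕ} {ρ : (Eucl n → ℝ≥0∞) → ℝ≥0∞} (hρ : IsBBFN n ρ) (k : ℕ) :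
    ρ (chi n k) ≠ ⊤ := (hρ.ball_mem 0 ((2:ℝ) ^ k) (by positivity)).ne

lemma rho_chi_pos {n : ℕ} {ρ : (Eucl n → ℝ≥0∞) → ℝ≥0∞} (hρ : IsBBFN n ρ) (k : ℕ) :
    ρ (chi n k) ≠ 0 := by
  intro h
  rw [hρ.zero_iff _ (chi_meas n k)] at h
  have h1 : ∫⁻ x, chi n k x = 0 := by
    rw [lintegral_congr_ae h]; simp
  unfold chi at h1
  rw [lintegral_indicator (DB_meas n k), setLIntegral_one] at h1
  have : 0 < volume (DB n k) := Metric.measure_ball_pos _ _ (by positivity)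
  exact this.ne' h1

lemma int_mul_chi {n : ℕ} (k : ℕ) (g : Eucl n → ℝ≥0∞) :
    ∫⁻ x, chi n k x * g x = ∫⁻ x in DB n k, g x := by
  rw [← lintegral_indicator (DB_meas n k)]
  congr 1
  ext x
  by_cases hx : x ∈ DB n k <;> simp [chi, hx]

lemma DB_mono {n : ℕ} {k m : ℕ} (h : k ≤ m) : DB n k ⊆ DB n m :=
  Metric.ball_subset_ball (pow_le_pow_right₀ (by norm_num) h)

lemma growth {n : ℕ} (hn : 1 ≤ n) {ρ : (Eucl n → ℝ≥0∞) → ℝ≥0∞} (hρ : IsBBFN n ρ)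
    (hM' : MBddOn n (kdual n ρ)) :
    ∃ q G : ℝ≥0, 1 < q ∧ 0 < G ∧ ∀ k : ℕ, (q : ℝ≥0∞) ^ k ≤ G * ρ (chi n k) := by
  obtain ⟨C, hC, hb⟩ := hM'
  set c : ℝ≥0 := C.toNNReal with hc
  have hc0 : 0 < c := Real.toNNReal_pos.2 hC
  obtain ⟨g, hgm, hgf, hgK, hgN⟩ := rdf (kdual n ρ) (kdual_tsum ρ) c hc0 hb (chi n 0) (chi_meas n 0)
  have hfin0 : kdual n ρ (chi n 0) ≠ ⊤ := by
    obtain ⟨C', _, h'⟩ := hρ.ball_lower 0 ((2:ℝ) ^ 0) (by positivity)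
    refine ne_top_of_le_ne_top (b := ENNReal.ofReal C') ENNReal.ofReal_ne_top ?_
    unfold kdual
    refine iSup₂_le fun φ hφ => ?_
    simp only [mul_comm (φ _)]
    rw [int_mul_chi]
    refine (h' φ hφ.1).trans ?_
    exact mul_le_of_le_one_right' hφ.2
  have hfin : kdual n ρ g ≠ ⊤ :=
    ne_top_of_le_ne_top (ENNReal.mul_ne_top (by norm_num) hfin0) hgN
  obtain ⟨v, hv⟩ : ∃ v : ℝ≥0, (v : ℝ≥0∞) = VB n :=
    ⟨(VB n).toNNReal, ENNReal.coe_toNNReal (VB_ne_top n)⟩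
  have hv0 : 0 < v := by
    have := VB_pos n
    rw [← hv] at this
    exact_mod_cast this
  set K : ℝ≥0 := 2 * c with hKd
  have hK0 : 0 < K := by positivity
  set d : ℝ≥0 := v / (4 ^ n * K) with hd
  have hd0 : 0 < d := by positivity
  have hdv : d * (4 ^ n * K) = v := by rw [hd]; field_simp
  have step : ∀ k, ((1 + d : ℝ≥0) : ℝ≥0∞) * ∫⁻ x in DB n k, g x ≤ ∫⁻ x in DB n (k+1), g x := by
    intro k
    set I := ∫⁻ x in DB n k, g x with hI
    have hsub : DB n k ⊆ DB n (k+1) := DB_mono (Nat.le_succ k)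
    have h1 : ∫⁻ x in DB n (k+1), g x = I + ∫⁻ x in DB n (k+1) \ DB n k, g x := by
      rw [← lintegral_inter_add_sdiff g (DB n (k+1)) (DB_meas n k),
        Set.inter_eq_self_of_subset_right hsub]
    rw [h1, ENNReal.coe_add, add_mul, ENNReal.coe_one, one_mul]
    gcongr
    have hvol : volume (DB n k) ≤ volume (DB n (k+1) \ DB n k) := by
      have e := measure_inter_add_sdiff (μ := volume) (DB n (k+1)) (DB_meas n k)
      rw [Set.inter_eq_self_of_subset_right hsub] at e
      have hne : volume (DB n k) ≠ ⊤ := measure_ball_lt_top.ne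
      have h2 : volume (DB n k) + volume (DB n k) ≤ volume (DB n (k+1)) := by
        rw [vol_DB, vol_DB, pow_succ, mul_pow]
        have : (2:ℝ≥0∞) ≤ 2 ^ n := by
          calc (2:ℝ≥0∞) = 2 ^ 1 := (pow_one _).symm
            _ ≤ 2 ^ n := pow_le_pow_right₀ (by norm_num) hn
        calc _ = (2 ^ k) ^ n * 2 * VB n := by ring
          _ ≤ _ := by gcongr
      rw [← e] at h2
      exact (ENNReal.add_le_add_iff_left hne).1 h2
    have hpt : ∀ x ∈ DB n (k+1), I ≤ 4 ^ n * (2 ^ k) ^ n * K * g x := by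
      intro x hx
      have h3 := int_le_hlm g x (r := (2:ℝ) ^ (k+2)) (by positivity)
      have h4 : I ≤ ∫⁻ y in Metric.ball x ((2:ℝ) ^ (k+2)), g y := by
        apply lintegral_mono_set
        intro y hy
        simp only [DB, Metric.mem_ball] at *
        have := dist_triangle_right y x 0
        have : (0:ℝ) < 2 ^ k := by positivity
        rw [pow_succ] at *
        rw [pow_succ]
        linarith
      refine (h4.trans h3).trans ?_
      rw [ofReal_two_pow]
      refine (mul_le_mul_right (hgK x) _).trans (le_of_eq ?_)
      rw [pow_add, mul_pow]
      norm_num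
      ring
    have h5 : I * volume (DB n k) ≤ 4 ^ n * (2 ^ k) ^ n * K * ∫⁻ x in DB n (k+1) \ DB n k, g x := by
      calc I * volume (DB n k) ≤ I * volume (DB n (k+1) \ DB n k) := by gcongr
        _ = ∫⁻ x in DB n (k+1) \ DB n k, I := by rw [setLIntegral_const]
        _ ≤ ∫⁻ x in DB n (k+1) \ DB n k, 4 ^ n * (2 ^ k) ^ n * K * g x :=
          setLIntegral_mono (hgm.const_mul _) fun x hx => hpt x hx.1
        _ = _ := lintegral_const_mul _ hgm
    rw [vol_DB, ← hv, ← hdv] at h5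
    set z : ℝ≥0 := 4 ^ n * (2 ^ k) ^ n * K with hz
    have hz0 : z ≠ 0 := by positivity
    have hzc : (z : ℝ≥0∞) = 4 ^ n * (2 ^ k) ^ n * K := by rw [hz]; push_cast; rfl
    rw [← ENNReal.mul_le_mul_iff_right (a := (z : ℝ≥0∞)) (by exact_mod_cast hz0) ENNReal.coe_ne_top]
    rw [← hzc] at h5
    refine le_trans (le_of_eq ?_) h5
    rw [hzc]
    push_cast
    ring
  have hIk : ∀ k, ((1 + d : ℝ≥0) : ℝ≥0∞) ^ k * v ≤ ∫⁻ x in DB n k, g x := by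
    intro k
    induction k with
    | zero =>
      have : volume (DB n 0) = v := by rw [vol_DB, hv]; simp
      rw [pow_zero, one_mul, ← this, ← setLIntegral_one]
      apply setLIntegral_mono hgm
      intro x hx
      refine le_trans ?_ (hgf x)
      simp [chi, hx]
    | succ k ih =>
      refine le_trans ?_ (step k)
      rw [pow_succ', mul_assoc]
      gcongr
  set G : ℝ≥0 := ((kdual n ρ g).toNNReal + 1) / v with hG
  refine ⟨1 + d, G, lt_add_of_pos_right _ hd0, by positivity, ?_⟩
  intro k
  have h1 := (hIk k).trans ((int_mul_chi k g).symm.le.trans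
    (kdual_holder hρ _ g (chi_meas n k) hgm (rho_chi_pos hρ k) (rho_chi_top hρ k)))
  rw [← ENNReal.mul_le_mul_iff_left (c := (v : ℝ≥0∞)) (by exact_mod_cast hv0.ne')
    ENNReal.coe_ne_top]
  refine h1.trans ?_
  have hGv : (G : ℝ≥0∞) * v = kdual n ρ g + 1 := by
    rw [← ENNReal.coe_mul]
    have : G * v = (kdual n ρ g).toNNReal + 1 := by rw [hG]; field_simp
    rw [this, ENNReal.coe_add, ENNReal.coe_toNNReal hfin, ENNReal.coe_one]
  calc ρ (chi n k) * kdual n ρ g ≤ ρ (chi n k) * (kdual n ρ g + 1) := by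
        gcongr; exact le_self_add
    _ = _ := by rw [← hGv]; ring

lemma local_emb {n : ℕ} (hn : 1 ≤ n) {ρ : (Eucl n → ℝ≥0∞) → ℝ≥0∞} (hρ : IsBBFN n ρ)
    (hM : MBddOn n ρ) (hM' : MBddOn n (kdual n ρ)) :
    ∃ (η : ℝ) (Q : ℝ≥0∞) (q : ℝ≥0), 1 < η ∧ Q ≠ ⊤ ∧ 1 < q ∧
      ∀ f : Eucl n → ℝ≥0∞, Measurable f → ρ f ≠ ⊤ → ∀ k : ℕ,
        ∫⁻ x in DB n k, f x ^ η ≤ Q * ((2 ^ k) ^ n * ((q⁻¹ : ℝ≥0) : ℝ≥0∞) ^ k) * ρ f ^ η := by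
  obtain ⟨q, G, hq, hG, hgr⟩ := growth hn hρ hM'
  obtain ⟨C, hC, hb⟩ := hM
  set c : ℝ≥0 := C.toNNReal with hc
  have hc0 : 0 < c := Real.toNNReal_pos.2 hC
  set K : ℝ≥0 := 2 * c with hKd
  have hK0 : 0 < K := by positivity
  obtain ⟨ε, Q, hε, hQ, hRH⟩ := revHolder n K
  obtain ⟨v, hv⟩ : ∃ v : ℝ≥0, (v : ℝ≥0∞) = VB n :=
    ⟨(VB n).toNNReal, ENNReal.coe_toNNReal (VB_ne_top n)⟩
  have hv0 : 0 < v := by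
    have := VB_pos n
    rw [← hv] at this
    exact_mod_cast this
  set A : ℝ≥0 := G * (2 ^ n * K * 2) / v with hA
  have hA0 : 0 < A := by positivity
  have hη : 0 < 1 + ε := by linarith
  have hq0 : 0 < q := zero_lt_one.trans hq
  refine ⟨1 + ε, Q * v * (A : ℝ≥0∞) ^ (1 + ε), q, by linarith, ?_, hq, ?_⟩
  · exact ENNReal.mul_ne_top (ENNReal.mul_ne_top hQ ENNReal.coe_ne_top)
      (ENNReal.rpow_ne_top_of_nonneg hη.le ENNReal.coe_ne_top)
  intro f hf hft k
  by_cases hf0 : ρ f = 0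
  · have h0 := (hρ.zero_iff f hf).1 hf0
    have : ∫⁻ x in DB n k, f x ^ (1 + ε) = 0 := by
      rw [lintegral_congr_ae (g := fun _ => 0)]
      · simp
      · filter_upwards [ae_restrict_of_ae h0] with x hx
        rw [hx]; simp [hη]
    rw [this]; exact zero_le'
  obtain ⟨h, hm, hfh, hhK, hhN⟩ := rdf ρ (rho_tsum hρ) c hc0 hb f hf
  rw [← hKd] at hhK
  set I := ∫⁻ x in DB n k, h x with hI
  have hht : ρ h ≠ ⊤ := ne_top_of_le_ne_top (ENNReal.mul_ne_top (by norm_num) hft) hhN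
  have hIt : I ≠ ⊤ := by
    obtain ⟨C', _, h'⟩ := hρ.ball_lower 0 ((2:ℝ) ^ k) (by positivity)
    exact ne_top_of_le_ne_top (ENNReal.mul_ne_top ENNReal.ofReal_ne_top hht) (h' h hm)
  have hpt : ∀ x ∈ DB n k, I ≤ ((2 ^ n * (2 ^ k) ^ n * K : ℝ≥0) : ℝ≥0∞) * h x := by
    intro x hx
    have h3 := int_le_hlm h x (r := (2:ℝ) ^ (k+1)) (by positivity)
    have h4 : I ≤ ∫⁻ y in Metric.ball x ((2:ℝ) ^ (k+1)), h y := by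
      apply lintegral_mono_set
      intro y hy
      simp only [DB, Metric.mem_ball] at *
      have := dist_triangle_right y x 0
      rw [pow_succ]
      linarith
    refine (h4.trans h3).trans ?_
    rw [ofReal_two_pow]
    refine (mul_le_mul_right (hhK x) _).trans (le_of_eq ?_)
    rw [pow_succ, mul_pow]
    push_cast
    ring
  have hIρ : I * ρ (chi n k) ≤ ((2 ^ n * (2 ^ k) ^ n * K : ℝ≥0) : ℝ≥0∞) * ρ h := by
    have e1 := hρ.smul I.toNNReal _ (chi_meas n k)
    rw [ENNReal.coe_toNNReal hIt] at e1
    rw [← e1, ← hρ.smul _ _ hm]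
    refine hρ.mono _ _ ((chi_meas n k).const_mul _) (hm.const_mul _) (Eventually.of_forall ?_)
    intro x
    by_cases hx : x ∈ DB n k
    · simpa [chi, hx] using hpt x hx
    · simp [chi, hx]
  obtain ⟨s, hs⟩ : ∃ s : ℝ≥0, (s : ℝ≥0∞) = ρ f := ⟨(ρ f).toNNReal, ENNReal.coe_toNNReal hft⟩
  have hs0 : 0 < s := by
    rw [← hs] at hf0
    exact pos_iff_ne_zero.2 (by exact_mod_cast hf0)
  set l : ℝ≥0 := A * q⁻¹ ^ k * s with hl
  have hl0 : 0 < l := by positivity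
  have hIl : I ≤ l * volume (DB n k) := by
    have h1 : (q : ℝ≥0∞) ^ k * I ≤ q ^ k * (l * volume (DB n k)) := by
      calc (q : ℝ≥0∞) ^ k * I ≤ G * ρ (chi n k) * I := by gcongr; exact hgr k
        _ = G * (I * ρ (chi n k)) := by ring
        _ ≤ G * (((2 ^ n * (2 ^ k) ^ n * K : ℝ≥0) : ℝ≥0∞) * (2 * ρ f)) := by
          refine mul_le_mul_right (hIρ.trans ?_) _
          exact mul_le_mul_right hhN _
        _ = q ^ k * (l * volume (DB n k)) := by
          rw [vol_DB, ← hv, ← hs]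
          have : G * ((2 ^ n * (2 ^ k) ^ n * K) * (2 * s)) = q ^ k * (l * ((2 ^ k) ^ n * v)) := by
            rw [hl, hA, inv_pow]; field_simp
          exact_mod_cast this
    rwa [ENNReal.mul_le_mul_iff_right] at h1
    · exact pow_ne_zero _ (by exact_mod_cast hq0.ne')
    · exact ENNReal.pow_ne_top ENNReal.coe_ne_top
  have hfinal := hRH h hm hhK ((2:ℝ) ^ k) (by positivity) hIt l hl0 hIl
  calc ∫⁻ x in DB n k, f x ^ (1 + ε) ≤ ∫⁻ x in DB n k, h x ^ (1 + ε) := by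
        gcongr with x
        exact hfh x
    _ ≤ Q * ((l : ℝ≥0∞) ^ (1 + ε) * volume (DB n k)) := hfinal
    _ ≤ Q * ((A : ℝ≥0∞) ^ (1 + ε) * ((q⁻¹ : ℝ≥0) : ℝ≥0∞) ^ k * ρ f ^ (1 + ε) *
          ((2 ^ k) ^ n * v)) := by
        rw [vol_DB, ← hv, hl, ENNReal.coe_mul, ENNReal.coe_mul, hs,
          ENNReal.mul_rpow_of_nonneg _ _ hη.le, ENNReal.mul_rpow_of_nonneg _ _ hη.le,
          ENNReal.coe_pow]
        gcongr
        have hle1 : ((q⁻¹ : ℝ≥0) : ℝ≥0∞) ^ k ≤ 1 := by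
          apply pow_le_one₀ zero_le'
          have : q⁻¹ ≤ 1 := inv_le_one_of_one_le₀ hq.le
          exact_mod_cast this
        calc (((q⁻¹ : ℝ≥0) : ℝ≥0∞) ^ k) ^ (1 + ε) ≤ (((q⁻¹ : ℝ≥0) : ℝ≥0∞) ^ k) ^ (1 : ℝ) :=
              ENNReal.rpow_le_rpow_of_exponent_ge hle1 (by linarith)
          _ = _ := ENNReal.rpow_one _
    _ = _ := by ring

lemma hlm_chi_le {n : ℕ} (k : ℕ) (x : Eucl n) : HLM (chi n k) x ≤ VB n := by
  unfold HLM
  refine iSup₂_le fun r hr => ?_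
  have h0 : ENNReal.ofReal (r ^ n) ≠ 0 := by
    simp only [ne_eq, ENNReal.ofReal_eq_zero, not_le]; positivity
  rw [mul_comm, ← div_eq_mul_inv, ENNReal.div_le_iff' h0 ENNReal.ofReal_ne_top, ← vol_ball x hr,
    ← setLIntegral_one]
  apply lintegral_mono
  intro y
  exact Set.indicator_le_self _ _ _

lemma hlm_chi_far {n : ℕ} (k m : ℕ) (hkm : k < m) (x : Eucl n) (hx : (2:ℝ) ^ m ≤ 2 * ‖x‖) :
    (2 ^ m) ^ n * HLM (chi n k) x ≤ 4 ^ n * (2 ^ k) ^ n * VB n := by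
  unfold HLM
  simp only [ENNReal.mul_iSup]
  refine iSup₂_le fun r hr => ?_
  have h0 : ENNReal.ofReal (r ^ n) ≠ 0 := by
    simp only [ne_eq, ENNReal.ofReal_eq_zero, not_le]; positivity
  have e : ∫⁻ y in Metric.ball x r, chi n k y = volume (DB n k ∩ Metric.ball x r) := by
    unfold chi
    rw [lintegral_indicator (DB_meas n k), Measure.restrict_restrict (DB_meas n k),
      setLIntegral_one]
  rw [e, mul_left_comm, mul_comm, ← div_eq_mul_inv, ENNReal.div_le_iff' h0 ENNReal.ofReal_ne_top]
  by_cases h4 : (2:ℝ) ^ m ≤ 4 * r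
  · calc (2 ^ m) ^ n * volume (DB n k ∩ Metric.ball x r)
        ≤ ENNReal.ofReal ((4 * r) ^ n) * volume (DB n k) := by
          rw [← ofReal_two_pow]
          gcongr
          exact Set.inter_subset_left
      _ = _ := by
          rw [vol_DB, mul_pow, ENNReal.ofReal_mul (by positivity),
            ENNReal.ofReal_pow (by norm_num : (0:ℝ) ≤ 4)]
          norm_num
          ring
  · push Not at h4
    by_cases hk : k + 1 = m
    · calc (2 ^ m) ^ n * volume (DB n k ∩ Metric.ball x r)
          ≤ (2 ^ m) ^ n * volume (Metric.ball x r) := by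
            gcongr
            exact Set.inter_subset_right
        _ ≤ 4 ^ n * (2 ^ k) ^ n * volume (Metric.ball x r) := by
            rw [← hk, pow_succ, mul_pow, mul_comm (((2 : ℝ≥0∞) ^ k) ^ n)]
            gcongr
            norm_num
        _ = _ := by
            rw [vol_ball x hr]; ring
    · have : DB n k ∩ Metric.ball x r = ∅ := by
        rw [Set.eq_empty_iff_forall_notMem]
        rintro y ⟨hy1, hy2⟩
        simp only [DB, Metric.mem_ball, dist_zero_right] at hy1 hy2
        have h5 : (2:ℝ) ^ (k + 2) ≤ 2 ^ m := pow_le_pow_right₀ (by norm_num) (by omega)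
        rw [pow_add] at h5
        have h6 : ‖x‖ ≤ ‖y‖ + dist y x := by
          rw [dist_comm, dist_eq_norm]
          have := norm_add_le y (x - y)
          simpa using this
        linarith
      rw [this]; simp

/-- The weight. -/
def wt (n : ℕ) (β : ℝ≥0) : Eucl n → ℝ≥0∞ := fun x => ∑' k, ((β ^ k : ℝ≥0) : ℝ≥0∞) * chi n k x

lemma wt_meas (n : ℕ) (β : ℝ≥0) : Measurable (wt n β) :=
  Measurable.ennreal_tsum fun k => (chi_meas n k).const_mul _

lemma exists_DB {n : ℕ} (x : Eucl n) : ∃ k, x ∈ DB n k := by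
  obtain ⟨k, hk⟩ := pow_unbounded_of_one_lt ‖x‖ (by norm_num : (1:ℝ) < 2)
  exact ⟨k, by simpa [DB] using hk⟩

lemma wt_ge {n : ℕ} (β : ℝ≥0) {x : Eucl n} {k : ℕ} (hx : x ∈ DB n k) :
    ((β ^ k : ℝ≥0) : ℝ≥0∞) ≤ wt n β x := by
  refine le_trans ?_ (ENNReal.le_tsum k)
  simp [chi, hx]

lemma wt_weight (n : ℕ) (β : ℝ≥0) (h0 : 0 < β) (h1 : β < 1) : IsWeight (wt n β) := by
  refine ⟨wt_meas n β, Eventually.of_forall fun x => ⟨?_, ?_⟩⟩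
  · obtain ⟨k, hk⟩ := exists_DB x
    refine lt_of_lt_of_le ?_ (wt_ge β hk)
    have : 0 < β ^ k := by positivity
    exact_mod_cast this
  · have hlt : (β : ℝ≥0∞) < 1 := by exact_mod_cast h1
    calc wt n β x ≤ ∑' k, (β : ℝ≥0∞) ^ k := by
          unfold wt
          refine ENNReal.tsum_le_tsum fun k => ?_
          rw [ENNReal.coe_pow]
          exact mul_le_of_le_one_right' (Set.indicator_le_self (DB n k) (fun _ => (1:ℝ≥0∞)) x)
      _ = (1 - (β : ℝ≥0∞))⁻¹ := ENNReal.tsum_geometric _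
      _ < ⊤ := by
          rw [ENNReal.inv_lt_top]
          exact tsub_pos_of_lt hlt

lemma wt_A1 (n : ℕ) (d : ℝ≥0) (hd : 0 < d) (x : Eucl n) :
    HLM (wt n ((d + 1) / 2 ^ n)) x ≤
      (VB n + 4 ^ n * VB n * ((d⁻¹ : ℝ≥0) : ℝ≥0∞)) * wt n ((d + 1) / 2 ^ n) x := by
  set β : ℝ≥0 := (d + 1) / 2 ^ n with hβ
  classical
  have hex := exists_DB x
  have hm := Nat.find_spec hex
  have hmin := fun j => Nat.find_min hex (m := j)
  set m := Nat.find hex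
  have hterm : ∀ k, ((β ^ k : ℝ≥0) : ℝ≥0∞) * HLM (chi n k) x ≤
      VB n * (((β ^ k : ℝ≥0) : ℝ≥0∞) * chi n k x) +
      (if k ∈ Finset.range m then
        4 ^ n * VB n * ((((2 ^ m) ^ n : ℝ≥0)⁻¹ : ℝ≥0) : ℝ≥0∞) * ((d : ℝ≥0∞) + 1) ^ k else 0) := by
    intro k
    by_cases hk : k < m
    · rw [if_pos (Finset.mem_range.2 hk)]
      refine le_trans ?_ le_add_self
      have hx : (2:ℝ) ^ m ≤ 2 * ‖x‖ := by
        have := hmin (m - 1) (by omega)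
        simp only [DB, Metric.mem_ball, dist_zero_right, not_lt] at this
        have e : (2:ℝ) ^ m = 2 * 2 ^ (m - 1) := by
          rw [← pow_succ']; congr 1; omega
        rw [e]; linarith
      have hfar := hlm_chi_far k m hk x hx
      set z : ℝ≥0 := (2 ^ m) ^ n with hz
      have hz0 : z ≠ 0 := by positivity
      have hzc : (z : ℝ≥0∞) = (2 ^ m) ^ n := by rw [hz]; push_cast; rfl
      have hzz : (z : ℝ≥0∞) * ((z⁻¹ : ℝ≥0) : ℝ≥0∞) = 1 := by
        rw [← ENNReal.coe_mul, mul_inv_cancel₀ hz0, ENNReal.coe_one]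
      have hβk : ((β ^ k : ℝ≥0) : ℝ≥0∞) * (2 ^ k) ^ n = ((d : ℝ≥0∞) + 1) ^ k := by
        have : β ^ k * (2 ^ k) ^ n = (d + 1) ^ k := by
          rw [← pow_mul, mul_comm k n, pow_mul, ← mul_pow, hβ]
          congr 1
          field_simp
        exact_mod_cast this
      rw [← hzc] at hfar
      calc ((β ^ k : ℝ≥0) : ℝ≥0∞) * HLM (chi n k) x
          = (z * ((z⁻¹ : ℝ≥0) : ℝ≥0∞)) * (((β ^ k : ℝ≥0) : ℝ≥0∞) * HLM (chi n k) x) := by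
            rw [hzz, one_mul]
        _ = ((z⁻¹ : ℝ≥0) : ℝ≥0∞) * ((β ^ k : ℝ≥0) : ℝ≥0∞) * (z * HLM (chi n k) x) := by ring
        _ ≤ ((z⁻¹ : ℝ≥0) : ℝ≥0∞) * ((β ^ k : ℝ≥0) : ℝ≥0∞) * (4 ^ n * (2 ^ k) ^ n * VB n) := by
            gcongr
        _ = ((z⁻¹ : ℝ≥0) : ℝ≥0∞) * 4 ^ n * VB n * (((β ^ k : ℝ≥0) : ℝ≥0∞) * (2 ^ k) ^ n) := by
            ring
        _ = _ := by rw [hβk]; ring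
    · refine le_trans ?_ le_self_add
      have hxk : x ∈ DB n k := DB_mono (not_lt.1 hk) hm
      have : chi n k x = 1 := by simp [chi, hxk]
      rw [this, mul_one, mul_comm]
      gcongr
      exact hlm_chi_le k x
  have h1 : HLM (wt n β) x ≤ ∑' k, ((β ^ k : ℝ≥0) : ℝ≥0∞) * HLM (chi n k) x := by
    refine (HLM_tsum_le _ (fun k => (chi_meas n k).const_mul _) x).trans (le_of_eq ?_)
    simp only [HLM_const_mul]
  refine h1.trans ((ENNReal.tsum_le_tsum hterm).trans ?_)
  rw [ENNReal.tsum_add, ENNReal.tsum_mul_left, add_mul]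
  refine add_le_add le_rfl ?_
  rw [tsum_eq_sum (s := Finset.range m) (fun k hk => if_neg hk),
    Finset.sum_congr rfl (fun k hk => if_pos hk), ← Finset.mul_sum]
  have hgeo : ∑ k ∈ Finset.range m, ((d : ℝ≥0∞) + 1) ^ k ≤
      ((d⁻¹ : ℝ≥0) : ℝ≥0∞) * ((d : ℝ≥0∞) + 1) ^ m := by
    rw [← geom_sum_mul_add]
    have hdd : ((d⁻¹ : ℝ≥0) : ℝ≥0∞) * d = 1 := by
      rw [← ENNReal.coe_mul, inv_mul_cancel₀ hd.ne', ENNReal.coe_one]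
    rw [mul_add, mul_left_comm, hdd, mul_one]
    exact le_self_add
  calc _ ≤ 4 ^ n * VB n * ((((2 ^ m) ^ n : ℝ≥0)⁻¹ : ℝ≥0) : ℝ≥0∞) *
        (((d⁻¹ : ℝ≥0) : ℝ≥0∞) * ((d : ℝ≥0∞) + 1) ^ m) := by gcongr
    _ = 4 ^ n * VB n * ((d⁻¹ : ℝ≥0) : ℝ≥0∞) * ((β ^ m : ℝ≥0) : ℝ≥0∞) := by
        have : ((2 ^ m) ^ n : ℝ≥0)⁻¹ * (d + 1) ^ m = β ^ m := by
          rw [hβ, div_pow, ← pow_mul, ← pow_mul, mul_comm n m]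
          field_simp
        rw [← this]
        push_cast
        ring
    _ ≤ _ := by
        gcongr
        exact wt_ge β hm

/-- **Remark 1.4 (embedding into a weighted Lebesgue space).** If `M` is bounded
on `X` and on `X'`, then `X ↪ L^η(w)` for some `η > 1` and some `w ∈ A₁`. -/
theorem embedding_into_weighted_Lp (n : ℕ) (hn : 1 ≤ n)
    (ρ : (Eucl n → ℝ≥0∞) → ℝ≥0∞) (hρ : IsBBFN n ρ)
    (hM : MBddOn n ρ) (hM' : MBddOn n (kdual n ρ)) :
    ∃ (η : ℝ) (w : Eucl n → ℝ≥0∞) (C : ℝ), 1 < η ∧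
      IsWeight w ∧ a1Const n w < ⊤ ∧ 0 < C ∧
      ∀ f : Eucl n → ℝ, Measurable f → normX ρ f < ⊤ →
        wLp n η w f ≤ ENNReal.ofReal C * normX ρ f := by
  obtain ⟨η, Q, q, hη, hQ, hq, hloc⟩ := local_emb hn hρ hM hM'
  have hη0 : 0 < η := by linarith
  have hq0 : 0 < q := zero_lt_one.trans hq
  obtain ⟨t, ht1, ht2⟩ := exists_between (lt_min hq (by norm_num : (1:ℝ≥0) < 2))
  obtain ⟨d, rfl⟩ : ∃ d, t = d + 1 := ⟨t - 1, (tsub_add_cancel_of_le ht1.le).symm⟩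
  have hd : 0 < d := by
    by_contra hcon
    have : d = 0 := by simpa using hcon
    rw [this] at ht1
    simp at ht1
  have htq : d + 1 < q := ht2.trans_le (min_le_left _ _)
  have ht2' : d + 1 < 2 := ht2.trans_le (min_le_right _ _)
  set β : ℝ≥0 := (d + 1) / 2 ^ n with hβ
  have hβ0 : 0 < β := by positivity
  have hβ1 : β < 1 := by
    rw [hβ, div_lt_one (by positivity)]
    calc d + 1 < 2 := ht2'
      _ = 2 ^ 1 := (pow_one _).symm
      _ ≤ 2 ^ n := pow_le_pow_right₀ (by norm_num) hn
  have hw := wt_weight n β hβ0 hβ1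
  set κ : ℝ≥0 := (d + 1) * q⁻¹ with hκ
  have hκ1 : κ < 1 := by
    rw [hκ, ← div_eq_mul_inv, div_lt_one hq0]; exact htq
  set S : ℝ≥0∞ := Q * (1 - (κ : ℝ≥0∞))⁻¹ with hS
  have hSt : S ≠ ⊤ := by
    refine ENNReal.mul_ne_top hQ ?_
    rw [ENNReal.inv_ne_top]
    exact (tsub_pos_of_lt (by exact_mod_cast hκ1)).ne'
  have hSt' : S ^ (1 / η) ≠ ⊤ := ENNReal.rpow_ne_top_of_nonneg (by positivity) hSt
  refine ⟨η, wt n β, (S ^ (1 / η)).toReal + 1, hη, hw, ?_, by positivity, ?_⟩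
  · have hle : a1Const n (wt n β) ≤ VB n + 4 ^ n * VB n * ((d⁻¹ : ℝ≥0) : ℝ≥0∞) := by
      unfold a1Const
      refine essSup_le_of_ae_le _ (Eventually.of_forall fun x => ?_)
      exact ENNReal.div_le_of_le_mul (wt_A1 n d hd x)
    refine lt_of_le_of_lt hle (lt_top_iff_ne_top.2 ?_)
    refine ENNReal.add_ne_top.2 ⟨VB_ne_top n, ENNReal.mul_ne_top (ENNReal.mul_ne_top ?_
      (VB_ne_top n)) ENNReal.coe_ne_top⟩
    exact ENNReal.pow_ne_top (by norm_num)
  intro f hf hft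
  set F : Eucl n → ℝ≥0∞ := fun x => (‖f x‖₊ : ℝ≥0∞) with hF
  have hFm : Measurable F := hf.nnnorm.coe_nnreal_ennreal
  have hFt : ρ F ≠ ⊤ := hft.ne
  have hFη : Measurable (fun x => F x ^ η) := hFm.pow_const η
  have main : ∫⁻ x, F x ^ η * wt n β x ≤ S * ρ F ^ η := by
    have e : ∀ x, F x ^ η * wt n β x = ∑' k, ((β ^ k : ℝ≥0) : ℝ≥0∞) * (chi n k x * F x ^ η) := by
      intro x
      unfold wt
      rw [← ENNReal.tsum_mul_left]
      congr 1
      ext k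
      ring
    have hmm : ∀ k, Measurable (fun x => chi n k x * F x ^ η) := fun k => (chi_meas n k).mul hFη
    simp only [e]
    rw [lintegral_tsum (fun k => ((hmm k).const_mul _).aemeasurable)]
    have hk : ∀ k, ∫⁻ x, ((β ^ k : ℝ≥0) : ℝ≥0∞) * (chi n k x * F x ^ η) ≤
        Q * ρ F ^ η * (κ : ℝ≥0∞) ^ k := by
      intro k
      rw [lintegral_const_mul _ (hmm k), int_mul_chi]
      refine (mul_le_mul_right (hloc F hFm hFt k) _).trans (le_of_eq ?_)
      have : β ^ k * ((2 ^ k) ^ n * q⁻¹ ^ k) = κ ^ k := by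
        rw [← pow_mul, mul_comm k n, pow_mul, ← mul_pow, ← mul_pow, hβ, hκ]
        congr 1
        field_simp
      rw [← ENNReal.coe_pow κ, ← this]
      push_cast
      ring
    refine (ENNReal.tsum_le_tsum hk).trans (le_of_eq ?_)
    rw [ENNReal.tsum_mul_left, ENNReal.tsum_geometric, hS]
    ring
  have hη1 : 0 ≤ 1 / η := by positivity
  calc wLp n η (wt n β) f = (∫⁻ x, F x ^ η * wt n β x) ^ (1 / η) := rfl
    _ ≤ (S * ρ F ^ η) ^ (1 / η) := by gcongr
    _ = S ^ (1 / η) * ρ F := by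
        rw [ENNReal.mul_rpow_of_nonneg _ _ hη1, ← ENNReal.rpow_mul, mul_one_div_cancel hη0.ne',
          ENNReal.rpow_one]
    _ ≤ ENNReal.ofReal ((S ^ (1 / η)).toReal + 1) * normX ρ f := by
        have : S ^ (1 / η) ≤ ENNReal.ofReal ((S ^ (1 / η)).toReal + 1) := by
          rw [← ENNReal.ofReal_toReal hSt']
          apply ENNReal.ofReal_le_ofReal
          rw [ENNReal.toReal_ofReal ENNReal.toReal_nonneg]
          linarith
        exact mul_le_mul_left this _
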